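/- Fix an integer $m\ge 3$, a constant $\lambda>0$, and a real parameter $a>0$. Let $\xi_n,\zeta_n$ be given by $\xi_{2r}=0$, $\xi_{2r+1}=\frac{(2r-1)!!}{(2r)!!}\cdot\frac{m-2}{2r+m-2}a^{2r}$, $\zeta_1=1$, $\zeta_n=\xi_n+\lambda\sum_{k=1}^{n-1}\zeta_{n-k}\xi_k$; and let $\theta_n,\gamma_n$ be given by $\theta_{2r}=0$, $\theta_{2r+1}=(-1)^r\frac{(1/2)_r}{(m/2)_r}a^{2r}$, $\gamma_1=1$, $\gamma_n=\theta_n+\lambda\sum_{k=1}^{n-1}\gamma_{n-k}\theta_k$. Then for every $t>0$ the two series representations of the characteristic function coincide: $\sqrt{\pi}\sum_{n=1}^{\infty}\frac{\zeta_n}{\Gamma(n/2)}\left(\frac{t}{2a}\right)^{(n-1)/2}J_{(n-1)/2}(at)=\sum_{n=0}^{\infty}\frac{\gamma_{n+1}}{n!}t^{n}$. -/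

import Mathlib

/-- Pochhammer symbol `(a)_n = a(a+1)⋯(a+n-1)` for a real `a`. -/
noncomputable def poch (a : ℝ) (n : ℕ) : ℝ := (ascPochhammer ℝ n).eval a

/-- Bessel function of the first kind of real order `ν`. -/
noncomputable def besselJ (ν z : ℝ) : ℝ :=
  ∑' k : ℕ, (-1 : ℝ) ^ k / (k.factorial * Real.Gamma ((k : ℝ) + ν + 1))
      * (z / 2) ^ (2 * (k : ℝ) + ν)

open Finset PowerSeries
open scoped Nat

lemma poch_zero (x : ℝ) : poch x 0 = 1 := by simp [poch]

lemma poch_succ (x : ℝ) (n : ℕ) : poch x (n + 1) = poch x n * (x + n) :=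
  ascPochhammer_succ_eval n x

lemma poch_pos {x : ℝ} (hx : 0 < x) (n : ℕ) : 0 < poch x n :=
  ascPochhammer_pos n x hx

lemma poch_succ_left (x : ℝ) (n : ℕ) : poch x (n + 1) = x * poch (x + 1) n := by
  simp [poch, ascPochhammer_succ_left]

lemma poch_add (x : ℝ) (m n : ℕ) : poch x (m + n) = poch x m * poch (x + m) n := by
  induction n with
  | zero => simp [poch_zero]
  | succ n ih => rw [← add_assoc, poch_succ, ih, poch_succ]; push_cast; ring

lemma poch_le_poch {x y : ℝ} (hx : 0 < x) (hxy : x ≤ y) (n : ℕ) : poch x n ≤ poch y n := by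
  induction n with
  | zero => simp [poch_zero]
  | succ n ih =>
    rw [poch_succ, poch_succ]
    exact mul_le_mul ih (by linarith) (by positivity) (poch_pos (hx.trans_le hxy) n).le

lemma factorial_mul_poch (n k : ℕ) : (n ! : ℝ) * poch (n + 1) k = (n + k)! := by
  have h := Nat.cast_ascFactorial ℝ (n + 1) k
  rw [poch, ← Nat.factorial_mul_ascFactorial]
  push_cast at h ⊢
  rw [h]

lemma Gamma_add_natCast {x : ℝ} (hx : 0 < x) (n : ℕ) :
    Real.Gamma (x + n) = Real.Gamma x * poch x n := by
  induction n with
  | zero => simp [poch_zero]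
  | succ n ih =>
    rw [Nat.cast_succ, ← add_assoc, Real.Gamma_add_one (by positivity), ih, poch_succ]
    ring

/-- Partial fraction expansion of `N! / (x (x + 1) ⋯ (x + N))`. -/
lemma sum_alternating_choose_div {x : ℝ} (hx : 0 < x) (N : ℕ) :
    ∑ j ∈ range (N + 1), (N.choose j : ℝ) * ((-1) ^ j / (x + j)) = N ! / poch x (N + 1) := by
  induction N generalizing x with
  | zero => simp [poch_succ, poch_zero]
  | succ N ih =>
    rw [sum_choose_succ_mul (fun j _ => (-1 : ℝ) ^ j / (x + j)) N, ih hx]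
    have h := ih (x := x + 1) (by linarith)
    have h2 : ∑ i ∈ range (N + 1), (N.choose i : ℝ) * ((-1) ^ (i + 1) / (x + (i + 1 : ℕ)))
        = -(N ! / poch (x + 1) (N + 1)) := by
      rw [← h, ← sum_neg_distrib]
      refine sum_congr rfl fun i _ => ?_
      push_cast
      rw [pow_succ, show x + ((i : ℝ) + 1) = x + 1 + i by ring]
      ring
    rw [h2, poch_succ_left x (N + 1), poch_succ_left x N, poch_succ (x + 1) N,
      Nat.factorial_succ]
    have h3 := poch_pos (x := x + 1) (by linarith) N
    have h4 : x + 1 + N ≠ 0 := by positivity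
    field_simp
    push_cast
    ring

lemma doubleFactorial_ratio (r : ℕ) :
    ((2 * r - 1)‼ : ℝ) / ((2 * r)‼ : ℝ) = poch (1 / 2) r / r ! := by
  induction r with
  | zero => simp [poch_zero]
  | succ r ih =>
    have h1 : (2 * (r + 1) - 1)‼ = (2 * r + 1) * (2 * r - 1)‼ := by
      cases r with
      | zero => simp
      | succ r => exact Nat.doubleFactorial_add_two (2 * r + 1)
    have h2 : (2 * (r + 1))‼ = (2 * r + 2) * (2 * r)‼ := Nat.doubleFactorial_add_two (2 * r)
    rw [h1, h2, poch_succ, Nat.factorial_succ]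
    push_cast
    rw [mul_div_mul_comm, ih]
    field_simp
    ring

/-- The formal power series `(1 + a² X²) ^ (-1/2)`. -/
noncomputable def invSqrtSeries (a : ℝ) : ℝ⟦X⟧ :=
  expand 2 two_ne_zero (rescale (a ^ 2) (PowerSeries.binomialSeries ℝ (-(1 / 2) : ℝ)))

lemma binomialSeries_pow (r : ℝ) (d : ℕ) :
    PowerSeries.binomialSeries ℝ r ^ d = PowerSeries.binomialSeries ℝ (d * r) := by
  induction d with
  | zero => simp
  | succ d ih => rw [pow_succ, ih, ← binomialSeries_add]; push_cast; ring_nf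

lemma ringChoose_neg (x : ℝ) (k : ℕ) : Ring.choose (-x) k = (-1) ^ k * poch x k / k ! := by
  have h := Ring.factorial_nsmul_multichoose_eq_ascPochhammer x k
  rw [Polynomial.ascPochhammer_smeval_eq_eval, nsmul_eq_mul] at h
  rw [Ring.choose_neg', poch, ← h, Int.negOnePow_def]
  have : (k ! : ℝ) ≠ 0 := by positivity
  field_simp
  simp [Units.smul_def]

lemma coeff_two_mul_invSqrtSeries_pow (a : ℝ) (d k : ℕ) :
    coeff (2 * k) (invSqrtSeries a ^ d)
      = (-1) ^ k * poch ((d : ℝ) / 2) k / k ! * a ^ (2 * k) := by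
  rw [invSqrtSeries, ← map_pow, ← map_pow, coeff_expand_mul, coeff_rescale, binomialSeries_pow,
    binomialSeries_coeff, show (d : ℝ) * -(1 / 2) = -(d / 2) by ring, ringChoose_neg,
    smul_eq_mul, mul_one, ← pow_mul]
  ring

lemma coeff_odd_invSqrtSeries_pow (a : ℝ) (d : ℕ) {k : ℕ} (hk : ¬ 2 ∣ k) :
    coeff k (invSqrtSeries a ^ d) = 0 := by
  rw [invSqrtSeries, ← map_pow, coeff_expand_of_not_dvd _ _ _ hk]

/-- The generating series `∑_{n ≥ 1} x_n X^n`. -/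
noncomputable def shiftedSeries (x : ℕ → ℝ) : ℝ⟦X⟧ := X * PowerSeries.mk fun n => x (n + 1)

lemma hasSubst_X_mul (S : ℝ⟦X⟧) : HasSubst (X * S) :=
  HasSubst.of_constantCoeff_zero' (by simp)

lemma coeff_succ_subst_shiftedSeries (S : ℝ⟦X⟧) (x : ℕ → ℝ) (N : ℕ) :
    coeff (N + 1) ((shiftedSeries x).subst (X * S))
      = ∑ n ∈ range (N + 1), x (n + 1) * coeff (N - n) (S ^ (n + 1)) := by
  rw [coeff_subst' (hasSubst_X_mul S), finsum_eq_sum_of_support_subset (s := range (N + 2)),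
    sum_range_succ']
  · rw [show coeff 0 (shiftedSeries x) = 0 by simp [shiftedSeries], zero_smul, add_zero]
    refine sum_congr rfl fun n hn => ?_
    have hn' : n + 1 ≤ N + 1 := by simpa [Nat.lt_succ_iff] using hn
    rw [shiftedSeries, coeff_succ_X_mul, coeff_mk, mul_pow, coeff_X_pow_mul', if_pos hn',
      Nat.add_sub_add_right, smul_eq_mul]
  · intro n hn
    by_contra h
    refine hn ?_
    have h' : ¬ n ≤ N + 1 := by simpa [Nat.lt_succ_iff] using h
    simp only [mul_pow, coeff_X_pow_mul', if_neg h', smul_zero]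

lemma recurrence_antidiagonal {x y : ℕ → ℝ} {lam : ℝ}
    (hy : ∀ n : ℕ, 2 ≤ n → y n = x n + lam * ∑ k ∈ Icc 1 (n - 1), y (n - k) * x k) (n : ℕ) :
    y (n + 2) = x (n + 2) + lam * ∑ p ∈ antidiagonal n, y (p.1 + 1) * x (p.2 + 1) := by
  rw [hy (n + 2) (by lia), ← Nat.sum_antidiagonal_swap,
    Nat.sum_antidiagonal_eq_sum_range_succ_mk, ← Ico_add_one_right_eq_Icc,
    sum_Ico_eq_sum_range]
  congr 2
  refine sum_congr (by simp) fun k hk => ?_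
  have : k < n + 1 := by simpa using hk
  simp only [Prod.swap]
  congr 2 <;> lia

lemma shiftedSeries_recurrence {x y : ℕ → ℝ} {lam : ℝ} (h1 : y 1 = x 1)
    (hy : ∀ n : ℕ, 2 ≤ n → y n = x n + lam * ∑ k ∈ Icc 1 (n - 1), y (n - k) * x k) :
    shiftedSeries y = shiftedSeries x + lam • (shiftedSeries y * shiftedSeries x) := by
  have key : (PowerSeries.mk fun n => y (n + 1))
      = (PowerSeries.mk fun n => x (n + 1)) + lam • (X * ((PowerSeries.mk fun n => y (n + 1)) * PowerSeries.mk fun n => x (n + 1))) := by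
    ext n
    cases n with
    | zero => simp [h1]
    | succ n =>
      rw [map_add, coeff_smul, coeff_succ_X_mul, coeff_mul]
      simpa using recurrence_antidiagonal hy n
  unfold shiftedSeries
  conv_lhs => rw [key]
  rw [mul_add, mul_smul_comm]
  congr 2
  ring

/-- The formal identity `Θ(X) = Ξ(X (1 + a² X²) ^ (-1/2))`, a form of Pfaff's transformation. -/
lemma shiftedSeries_pfaff {m : ℕ} (hm : 3 ≤ m) {a : ℝ} {ξ θ : ℕ → ℝ}
    (hξeven : ∀ r : ℕ, ξ (2 * r) = 0)
    (hξodd : ∀ r : ℕ, ξ (2 * r + 1) = ((2 * r - 1)‼ : ℝ) / ((2 * r)‼ : ℝ)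
        * (((m : ℝ) - 2) / (2 * (r : ℝ) + (m : ℝ) - 2)) * a ^ (2 * r))
    (hθeven : ∀ r : ℕ, θ (2 * r) = 0)
    (hθodd : ∀ r : ℕ, θ (2 * r + 1)
      = (-1 : ℝ) ^ r * poch (1 / 2) r / poch ((m : ℝ) / 2) r * a ^ (2 * r)) :
    shiftedSeries θ = (shiftedSeries ξ).subst (X * invSqrtSeries a) := by
  have hm' : (3 : ℝ) ≤ m := by exact_mod_cast hm
  ext N
  cases N with
  | zero =>
    rw [coeff_zero_eq_constantCoeff_apply, coeff_zero_eq_constantCoeff_apply]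
    have := constantCoeff_subst_eq_zero (a := (X * invSqrtSeries a : ℝ⟦X⟧))
      (show constantCoeff (X * invSqrtSeries a) = 0 by simp) (shiftedSeries ξ)
      (by simp [shiftedSeries])
    refine Eq.trans ?_ this.symm
    simp [shiftedSeries]
  | succ N =>
    rw [coeff_succ_subst_shiftedSeries, shiftedSeries, coeff_succ_X_mul, coeff_mk]
    obtain ⟨M, rfl | rfl⟩ := N.even_or_odd'
    · have split : ∀ (f : ℕ → ℝ), (∀ j, f (2 * j + 1) = 0) →
          ∑ n ∈ range (2 * M + 1), f n = ∑ j ∈ range (M + 1), f (2 * j) := by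
        intro f hf
        induction M with
        | zero => simp
        | succ M ih => rw [sum_range_succ _ (M + 1), ← ih, mul_add, sum_range_succ,
            sum_range_succ, hf, add_zero]
      rw [split _ fun j => by
        rw [show 2 * j + 1 + 1 = 2 * (j + 1) by ring, hξeven, zero_mul], hθodd]
      set x : ℝ := (m : ℝ) / 2 - 1 with hx
      have hx0 : 0 < x := by linarith
      have hP := sum_alternating_choose_div hx0 M
      rw [poch_succ_left, show x + 1 = (m : ℝ) / 2 by rw [hx]; ring] at hP
      have hPm := (poch_pos (show 0 < (m : ℝ) / 2 by positivity) M).ne'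
      have hfac : (M ! : ℝ) ≠ 0 := by positivity
      have hcoef : (-1 : ℝ) ^ M * poch (1 / 2) M / poch ((m : ℝ) / 2) M * a ^ (2 * M)
          = (-1 : ℝ) ^ M * poch (1 / 2) M * a ^ (2 * M) * x / M ! *
            (M ! / (x * poch ((m : ℝ) / 2) M)) := by
        field_simp
      rw [hcoef, ← hP, mul_sum]
      refine sum_congr rfl fun j hj => ?_
      obtain ⟨k, rfl⟩ : ∃ k, M = j + k :=
        Nat.exists_eq_add_of_le (Nat.lt_succ_iff.mp (by simpa using hj))
      rw [hξodd, doubleFactorial_ratio, show 2 * (j + k) - 2 * j = 2 * k by lia,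
        coeff_two_mul_invSqrtSeries_pow, poch_add,
        show ((2 * j + 1 : ℕ) : ℝ) / 2 = 1 / 2 + j by push_cast; ring,
        Nat.cast_choose ℝ (Nat.le_add_right j k), Nat.add_sub_cancel_left,
        show (m : ℝ) - 2 = 2 * x by rw [hx]; ring,
        show 2 * (j : ℝ) + m - 2 = 2 * (x + j) by rw [hx]; ring]
      have hxj : x + j ≠ 0 := by positivity
      have hs : (-1 : ℝ) ^ j * (-1) ^ j = 1 := by rw [← mul_pow]; simp
      rw [pow_add (-1 : ℝ) j k, mul_add 2 j k, pow_add a]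
      generalize poch (1 / 2 + (j : ℝ)) k = P
      field_simp
      linear_combination (poch (1 / 2) j * P * a ^ (2 * j) * a ^ (2 * k)) * hs
    · rw [show 2 * M + 1 + 1 = 2 * (M + 1) by ring, hθeven]
      refine (sum_eq_zero fun n hn => ?_).symm
      obtain ⟨j, rfl | rfl⟩ := n.even_or_odd'
      · rw [coeff_odd_invSqrtSeries_pow, mul_zero]
        have : 2 * j < 2 * (M + 1) := by simpa using hn
        lia
      · rw [show 2 * j + 1 + 1 = 2 * (j + 1) by ring, hξeven, zero_mul]

/-- Solutions of the renewal-type recurrence are transported by substitution. -/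
lemma recurrence_subst {x y x' y' : ℕ → ℝ} {lam : ℝ} (S : ℝ⟦X⟧)
    (h1 : y 1 = x 1) (h1' : y' 1 = x' 1)
    (hy : ∀ n : ℕ, 2 ≤ n → y n = x n + lam * ∑ k ∈ Icc 1 (n - 1), y (n - k) * x k)
    (hy' : ∀ n : ℕ, 2 ≤ n → y' n = x' n + lam * ∑ k ∈ Icc 1 (n - 1), y' (n - k) * x' k)
    (hx : shiftedSeries x' = (shiftedSeries x).subst (X * S)) (N : ℕ) :
    y' (N + 1) = ∑ n ∈ range (N + 1), y (n + 1) * coeff (N - n) (S ^ (n + 1)) := by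
  have hs := hasSubst_X_mul S
  have e1 := congrArg (subst (X * S)) (shiftedSeries_recurrence h1 hy)
  rw [subst_add hs, subst_smul hs, subst_mul hs, ← hx] at e1
  have e2 := shiftedSeries_recurrence h1' hy'
  have hne : (1 - lam • shiftedSeries x' : ℝ⟦X⟧) ≠ 0 := by
    intro h
    have := congrArg constantCoeff h
    simp [shiftedSeries] at this
  have e3 : (shiftedSeries y' - (shiftedSeries y).subst (X * S))
      * (1 - lam • shiftedSeries x') = 0 := by
    rw [smul_eq_C_mul] at e1 e2 ⊢
    linear_combination e2 - e1
  have e4 := sub_eq_zero.mp ((mul_eq_zero.mp e3).resolve_right hne)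
  rw [← coeff_succ_subst_shiftedSeries, ← e4, shiftedSeries, coeff_succ_X_mul, coeff_mk]

lemma recurrence_bound {x y : ℕ → ℝ} {lam a : ℝ} (hlam : 0 < lam) (ha : 0 < a)
    (h1 : y 1 = x 1) (hx : ∀ n, |x (n + 1)| ≤ a ^ n)
    (hy : ∀ n : ℕ, 2 ≤ n → y n = x n + lam * ∑ k ∈ Icc 1 (n - 1), y (n - k) * x k) (n : ℕ) :
    |y (n + 1)| ≤ (a + lam) ^ n := by
  induction n using Nat.strong_induction_on with
  | _ n ih =>
    cases n with
    | zero => simpa [h1] using hx 0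
    | succ n =>
      rw [recurrence_antidiagonal hy]
      have hsum : |∑ p ∈ antidiagonal n, y (p.1 + 1) * x (p.2 + 1)|
          ≤ ∑ p ∈ antidiagonal n, (a + lam) ^ p.1 * a ^ p.2 := by
        refine (abs_sum_le_sum_abs _ _).trans (sum_le_sum fun p hp => ?_)
        rw [abs_mul]
        have : p.1 + p.2 = n := by simpa using hp
        exact mul_le_mul (ih _ (by lia)) (hx _) (abs_nonneg _) (by positivity)
      have hgeom : lam * ∑ p ∈ antidiagonal n, (a + lam) ^ p.1 * a ^ p.2
          = (a + lam) ^ (n + 1) - a ^ (n + 1) := by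
        rw [Nat.sum_antidiagonal_eq_sum_range_succ_mk, ← geom_sum₂_mul (a + lam) a (n + 1)]
        simp [mul_comm]
      calc |x (n + 2) + lam * ∑ p ∈ antidiagonal n, y (p.1 + 1) * x (p.2 + 1)|
          ≤ |x (n + 2)| + lam * |∑ p ∈ antidiagonal n, y (p.1 + 1) * x (p.2 + 1)| := by
            conv_rhs => rw [← abs_of_pos hlam, ← abs_mul]
            exact abs_add_le _ _
        _ ≤ a ^ (n + 1) + lam * ∑ p ∈ antidiagonal n, (a + lam) ^ p.1 * a ^ p.2 :=
            add_le_add (hx (n + 1)) (mul_le_mul_of_nonneg_left hsum hlam.le)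
        _ = (a + lam) ^ (n + 1) := by rw [hgeom]; ring

lemma abs_xi_le {m : ℕ} (hm : 3 ≤ m) {a : ℝ} (ha : 0 < a) {ξ : ℕ → ℝ}
    (hξeven : ∀ r : ℕ, ξ (2 * r) = 0)
    (hξodd : ∀ r : ℕ, ξ (2 * r + 1) = ((2 * r - 1)‼ : ℝ) / ((2 * r)‼ : ℝ)
        * (((m : ℝ) - 2) / (2 * (r : ℝ) + (m : ℝ) - 2)) * a ^ (2 * r)) (n : ℕ) :
    |ξ (n + 1)| ≤ a ^ n := by
  have hm' : (3 : ℝ) ≤ m := by exact_mod_cast hm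
  obtain ⟨r, rfl | rfl⟩ := n.even_or_odd'
  · have h0 : 0 < (m : ℝ) - 2 := by linarith
    have h1 : 0 < 2 * (r : ℝ) + m - 2 := by have := r.cast_nonneg (α := ℝ); linarith
    have h2 : ((2 * r - 1)‼ : ℝ) / ((2 * r)‼ : ℝ) ≤ 1 := by
      rw [doubleFactorial_ratio, div_le_one (by positivity)]
      have := factorial_mul_poch 0 r
      have h3 := poch_le_poch (x := 1 / 2) (y := 1) (by norm_num) (by norm_num) r
      simp at this
      linarith
    have h3 : ((m : ℝ) - 2) / (2 * (r : ℝ) + (m : ℝ) - 2) ≤ 1 := by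
      rw [div_le_one h1]
      have := r.cast_nonneg (α := ℝ)
      linarith
    rw [hξodd, abs_of_nonneg (by positivity)]
    exact mul_le_of_le_one_left (by positivity) (mul_le_one₀ h2 (by positivity) h3)
  · rw [show 2 * r + 1 + 1 = 2 * (r + 1) by ring, hξeven, abs_zero]
    positivity

lemma sqrt_pi_mul_bessel_term {a t : ℝ} (ha : 0 < a) (ht : 0 < t) (n k : ℕ) :
    Real.sqrt Real.pi * (1 / Real.Gamma (((n : ℝ) + 1) / 2) * (t / (2 * a)) ^ ((n : ℝ) / 2)
      * ((-1 : ℝ) ^ k / (k ! * Real.Gamma ((k : ℝ) + (n : ℝ) / 2 + 1))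
        * (a * t / 2) ^ (2 * (k : ℝ) + (n : ℝ) / 2)))
    = (-1) ^ k * poch (((n + 1 : ℕ) : ℝ) / 2) k / k ! * a ^ (2 * k)
      * (t ^ (n + 2 * k) / (n + 2 * k)!) := by
  have hpow : (t / (2 * a)) ^ ((n : ℝ) / 2) * (a * t / 2) ^ (2 * (k : ℝ) + (n : ℝ) / 2)
      = t ^ (n + 2 * k) * a ^ (2 * k) / 2 ^ (n + 2 * k) := by
    rw [Real.rpow_add (by positivity), mul_left_comm,
      ← Real.mul_rpow (by positivity) (by positivity),
      show t / (2 * a) * (a * t / 2) = (t / 2) ^ (2 : ℝ) by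
        rw [Real.rpow_two]; field_simp,
      ← Real.rpow_mul (by positivity), mul_div_cancel₀ _ (two_ne_zero), Real.rpow_natCast,
      show 2 * (k : ℝ) = ((2 * k : ℕ) : ℝ) by push_cast; ring, Real.rpow_natCast]
    simp only [div_pow, mul_pow, pow_add]
    field_simp
  have hpos : 0 < ((n : ℝ) + 1) / 2 := by positivity
  have hdup := Real.Gamma_mul_Gamma_add_half (((n : ℝ) + 1) / 2 + k)
  rw [Gamma_add_natCast hpos,
    show ((n : ℝ) + 1) / 2 + k + 1 / 2 = k + (n : ℝ) / 2 + 1 by ring,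
    show 2 * (((n : ℝ) + 1) / 2 + k) = ((n + 2 * k : ℕ) : ℝ) + 1 by push_cast; ring,
    Real.Gamma_nat_eq_factorial,
    show 1 - (((n + 2 * k : ℕ) : ℝ) + 1) = -((n + 2 * k : ℕ) : ℝ) by ring,
    Real.rpow_neg (by norm_num), Real.rpow_natCast] at hdup
  have hG1 := (Real.Gamma_pos_of_pos hpos).ne'
  have hG2 := (Real.Gamma_pos_of_pos (show 0 < (k : ℝ) + (n : ℝ) / 2 + 1 by positivity)).ne'
  have hf : ((n + 2 * k)! : ℝ) ≠ 0 := by positivity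
  have hk : (k ! : ℝ) ≠ 0 := by positivity
  have h2 : (2 : ℝ) ^ (n + 2 * k) ≠ 0 := by positivity
  have hsplit : ∀ g p q r s : ℝ, s * (1 / g * p * (q * r)) = s * (1 / g) * q * (p * r) := by
    intros; ring
  rw [hsplit, hpow]
  push_cast
  field_simp at hdup ⊢
  linear_combination (-(1 : ℝ)) * hdup

lemma summable_double_series {a t lam : ℝ} (hlam : 0 < lam) (ha : 0 < a) (ht : 0 < t)
    {ζ : ℕ → ℝ} (hζ : ∀ n, |ζ (n + 1)| ≤ (a + lam) ^ n) :
    Summable fun p : ℕ × ℕ => ζ (p.1 + 1) * coeff (2 * p.2) (invSqrtSeries a ^ (p.1 + 1))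
      * (t ^ (p.1 + 2 * p.2) / (p.1 + 2 * p.2)!) := by
  have hs := (Real.summable_pow_div_factorial ((a + lam) * t)).mul_of_nonneg
    (Real.summable_pow_div_factorial ((a * t) ^ 2)) (fun n => by positivity)
    (fun n => by positivity)
  refine Summable.of_norm_bounded hs fun ⟨n, k⟩ => ?_
  have hP0 := poch_pos (show 0 < ((n + 1 : ℕ) : ℝ) / 2 by positivity) k
  have hP : poch (((n + 1 : ℕ) : ℝ) / 2) k / (n + 2 * k)! ≤ 1 / n ! := by
    have h1 := poch_le_poch (x := ((n + 1 : ℕ) : ℝ) / 2) (y := n + 1) (by positivity)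
      (by push_cast; have := n.cast_nonneg (α := ℝ); linarith) k
    have h2 := factorial_mul_poch n k
    have h3 : ((n + k)! : ℝ) ≤ (n + 2 * k)! := by
      exact_mod_cast Nat.factorial_le (by lia)
    rw [div_le_div_iff₀ (by positivity) (by positivity)]
    have h4 : (0 : ℝ) < n ! := by positivity
    nlinarith
  rw [Real.norm_eq_abs, coeff_two_mul_invSqrtSeries_pow, abs_mul, abs_mul, abs_mul, abs_div,
    abs_mul, abs_pow, abs_neg, abs_one, one_pow, one_mul, abs_of_pos hP0, Nat.abs_cast,
    abs_of_pos (show 0 < a ^ (2 * k) by positivity),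
    abs_of_pos (show 0 < t ^ (n + 2 * k) / (n + 2 * k)! by positivity)]
  calc |ζ (n + 1)| * (poch (((n + 1 : ℕ) : ℝ) / 2) k / k ! * a ^ (2 * k))
        * (t ^ (n + 2 * k) / (n + 2 * k)!)
      = |ζ (n + 1)| * (poch (((n + 1 : ℕ) : ℝ) / 2) k / (n + 2 * k)!)
        * (a ^ (2 * k) * t ^ (n + 2 * k) / k !) := by ring
    _ ≤ (a + lam) ^ n * (1 / n !) * (a ^ (2 * k) * t ^ (n + 2 * k) / k !) := by
        gcongr
        exact hζ n
    _ = ((a + lam) * t) ^ n / n ! * (((a * t) ^ 2) ^ k / k !) := by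
        rw [mul_pow, ← pow_mul, mul_pow, pow_add]
        ring

/-- the Bessel-series and the time-series representations of the
characteristic function of the `m`-dimensional symmetric Markov random flight coincide
(both sums written with the index shift `n ↦ n+1`, summing over `n : ℕ`). -/
theorem stmt10 (m : ℕ) (hm : 3 ≤ m) (lam a : ℝ) (hlam : 0 < lam) (ha : 0 < a)
    (ξ ζ θ γ : ℕ → ℝ)
    (hξeven : ∀ r : ℕ, ξ (2 * r) = 0)
    (hξodd : ∀ r : ℕ, ξ (2 * r + 1)
      = ((2 * r - 1).doubleFactorial : ℝ) / ((2 * r).doubleFactorial : ℝ)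
        * (((m : ℝ) - 2) / (2 * (r : ℝ) + (m : ℝ) - 2)) * a ^ (2 * r))
    (hζ1 : ζ 1 = 1)
    (hζ : ∀ n : ℕ, 2 ≤ n →
      ζ n = ξ n + lam * ∑ k ∈ Finset.Icc 1 (n - 1), ζ (n - k) * ξ k)
    (hθeven : ∀ r : ℕ, θ (2 * r) = 0)
    (hθodd : ∀ r : ℕ, θ (2 * r + 1)
      = (-1 : ℝ) ^ r * poch (1 / 2) r / poch ((m : ℝ) / 2) r * a ^ (2 * r))
    (hγ1 : γ 1 = 1)
    (hγ : ∀ n : ℕ, 2 ≤ n →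
      γ n = θ n + lam * ∑ k ∈ Finset.Icc 1 (n - 1), γ (n - k) * θ k) :
    ∀ t : ℝ, 0 < t →
      Real.sqrt Real.pi *
          ∑' n : ℕ, ζ (n + 1) / Real.Gamma (((n : ℝ) + 1) / 2)
            * (t / (2 * a)) ^ ((n : ℝ) / 2) * besselJ ((n : ℝ) / 2) (a * t)
        = ∑' n : ℕ, γ (n + 1) / n.factorial * t ^ n := by
  intro t ht
  have hm' : (3 : ℝ) ≤ m := by exact_mod_cast hm
  have hξ1 : ξ 1 = 1 := by
    have h0 : (m : ℝ) - 2 ≠ 0 := by linarith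
    simpa [h0] using hξodd 0
  have hθ1 : θ 1 = 1 := by simpa [poch_zero] using hθodd 0
  have hbound := recurrence_bound hlam ha (hζ1.trans hξ1.symm) (abs_xi_le hm ha hξeven hξodd) hζ
  have hγζ := recurrence_subst (invSqrtSeries a) (hζ1.trans hξ1.symm) (hγ1.trans hθ1.symm) hζ hγ
    (shiftedSeries_pfaff hm hξeven hξodd hθeven hθodd)
  let F : ℕ → ℕ → ℝ := fun n N => if n ≤ N then
    ζ (n + 1) * coeff (N - n) (invSqrtSeries a ^ (n + 1)) * (t ^ N / N !) else 0
  have hF : ∀ n k, F n (n + 2 * k) = ζ (n + 1) * coeff (2 * k) (invSqrtSeries a ^ (n + 1))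
      * (t ^ (n + 2 * k) / (n + 2 * k)!) := fun n k => by simp [F]
  have hF0 : ∀ n N, (∀ k, n + 2 * k ≠ N) → F n N = 0 := by
    intro n N h
    simp only [F]
    split_ifs with hn
    · rw [coeff_odd_invSqrtSeries_pow, mul_zero, zero_mul]
      rintro ⟨k, hk⟩
      exact h k (by lia)
    · rfl
  have hsummable : Summable (Function.uncurry F) := by
    have hinj : Function.Injective fun p : ℕ × ℕ => (p.1, p.1 + 2 * p.2) := by
      rintro ⟨n, k⟩ ⟨n', k'⟩ h
      simp only [Prod.mk.injEq] at h ⊢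
      lia
    refine (hinj.summable_iff ?_).mp
      ((summable_double_series hlam ha ht hbound).congr fun p => (hF p.1 p.2).symm)
    rintro ⟨n, N⟩ h
    exact hF0 n N fun k hk => h ⟨(n, k), by simp [hk]⟩
  have hrow : ∀ n : ℕ, ∑' N, F n N = Real.sqrt Real.pi *
      (ζ (n + 1) / Real.Gamma (((n : ℝ) + 1) / 2)
      * (t / (2 * a)) ^ ((n : ℝ) / 2) * besselJ ((n : ℝ) / 2) (a * t)) := by
    intro n
    have hinj : Function.Injective fun k : ℕ => n + 2 * k := fun k k' h => by
      simpa using h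
    rw [← hinj.tsum_eq, besselJ, ← tsum_mul_left, ← tsum_mul_left]
    · refine tsum_congr fun k => ?_
      rw [hF, coeff_two_mul_invSqrtSeries_pow, mul_assoc (ζ (n + 1)),
        ← sqrt_pi_mul_bessel_term ha ht]
      ring
    · intro N hN
      by_contra h
      exact hN (hF0 n N fun k hk => h ⟨k, hk⟩)
  have hcol : ∀ N : ℕ, ∑' n, F n N = γ (N + 1) / N ! * t ^ N := by
    intro N
    rw [tsum_eq_sum (s := range (N + 1)), hγζ, div_mul_eq_mul_div, mul_div_assoc, sum_mul]
    · refine sum_congr rfl fun n hn => if_pos ?_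
      simpa [Nat.lt_succ_iff] using hn
    · intro n hn
      refine if_neg ?_
      simpa [Nat.lt_succ_iff] using hn
  rw [← tsum_mul_left]
  simp_rw [← hrow, ← hcol]
  exact hsummable.tsum_comm.symm
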